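/- arXiv:2511.13969 — 6 statements merged into one kernel-verified Lean document; each statement's English description precedes it below -/
import Mathlib

section
/- Let N ≥ 1 be a natural number and let Q be an exact divisor of N. Then the sum, over all divisors N' of N such that N/N' is squarefree, of μ(Q / gcd(Q, N')) · (N' / gcd(Q, N')) equals ψ(N) if Q = 1 and equals 0 if Q > 1. Here μ is the Möbius function and ψ(N) := Σ_{d ∣ N, N/d squarefree} d is the Dedekind psi function (the multiplicative function with ψ(p^r) = p^r + p^{r−1} on prime powers). -/
theorem exponent_eq_of_pow_mul_eq_pow_mul {p : ℕ} (hp : p.Prime) {s t a b : ℕ} (ha : ¬ p ∣ a)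
    (hb : ¬ p ∣ b) (h : p ^ s * a = p ^ t * b) : s = t := by
  have key : ∀ {s a : ℕ}, ¬ p ∣ a → padicValNat p (p ^ s * a) = s := by
    intro s a ha
    have : Fact p.Prime := ⟨hp⟩
    have ha0 : a ≠ 0 := by rintro rfl; simp at ha
    rw [padicValNat.mul (pow_ne_zero _ hp.ne_zero) ha0, padicValNat.prime_pow,
      padicValNat.eq_zero_of_not_dvd ha, add_zero]
  rw [← key (s := s) ha, h, key hb]

/-- If a prime `p` divides the exact divisor `Q` of `p * a * e` and `p` does not divide `e`, then
replacing `a` by `p * a` flips the sign of `μ (Q / gcd Q a) * (a / gcd Q a)`. -/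
theorem moebius_div_gcd_mul_add_eq_zero {p : ℕ} (hp : p.Prime) {Q a e c : ℕ}
    (ha : a ≠ 0) (he : ¬ p ∣ e) (hpQ : p ∣ Q) (hcop : Nat.Coprime Q c)
    (h : p * a * e = Q * c) :
    (ArithmeticFunction.moebius (Q / Nat.gcd Q a) : ℤ) * ((a / Nat.gcd Q a : ℕ) : ℤ) +
      (ArithmeticFunction.moebius (Q / Nat.gcd Q (p * a)) : ℤ) *
        ((p * a / Nat.gcd Q (p * a) : ℕ) : ℤ) = 0 := by
  have hc : ¬ p ∣ c := fun hc => hp.one_lt.ne' (Nat.eq_one_of_dvd_coprimes hcop hpQ hc)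
  have hQ : Q ≠ 0 := by
    rintro rfl
    have he0 : e ≠ 0 := by rintro rfl; simp at he
    simp [ha, he0, hp.ne_zero] at h
  obtain ⟨s, m, hm, rfl⟩ := Nat.exists_eq_pow_mul_and_not_dvd ha p hp.ne_one
  obtain ⟨t, q, hq, rfl⟩ := Nat.exists_eq_pow_mul_and_not_dvd hQ p hp.ne_one
  obtain rfl : s + 1 = t := exponent_eq_of_pow_mul_eq_pow_mul hp (hp.not_dvd_mul hm he)
    (hp.not_dvd_mul hq hc) (by rw [← mul_assoc (p ^ t), ← h]; ring)
  have hpm : Nat.Coprime p m := (hp.coprime_iff_not_dvd).2 hm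
  have hps : 0 < p ^ s := pow_pos hp.pos s
  have hps' : 0 < p ^ (s + 1) := pow_pos hp.pos _
  have hm0 : 0 < m := Nat.pos_of_ne_zero (by rintro rfl; simp at hm)
  have hg : 0 < Nat.gcd q m := Nat.gcd_pos_of_pos_right _ hm0
  have hmul : p * (p ^ s * m) = p ^ (s + 1) * m := by ring
  have hgcd : Nat.gcd (p ^ (s + 1) * q) (p ^ s * m) = p ^ s * Nat.gcd q m := by
    rw [pow_succ, mul_assoc, Nat.gcd_mul_left, hpm.gcd_mul_left_cancel]
  obtain ⟨k, hk⟩ := Nat.gcd_dvd_left q m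
  have hpk : Nat.Coprime p k :=
    (hp.coprime_iff_not_dvd).2 fun h' => hq (hk ▸ h'.mul_left _)
  have hdiv : p ^ (s + 1) * q / (p ^ s * Nat.gcd q m) = p * k := by
    rw [pow_succ, mul_assoc, Nat.mul_div_mul_left _ _ hps]
    refine Nat.div_eq_of_eq_mul_left hg ?_
    calc p * q = p * (Nat.gcd q m * k) := by rw [← hk]
      _ = p * k * Nat.gcd q m := by ring
  have hdiv' : q / Nat.gcd q m = k :=
    Nat.div_eq_of_eq_mul_right hg hk
  rw [hmul, hgcd, Nat.gcd_mul_left, hdiv, Nat.mul_div_mul_left _ _ hps,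
    Nat.mul_div_mul_left _ _ hps', Nat.mul_div_mul_left _ _ hps', hdiv',
    ArithmeticFunction.isMultiplicative_moebius.map_mul_of_coprime hpk,
    ArithmeticFunction.moebius_apply_prime hp]
  ring

open ArithmeticFunction in
theorem stmt_2 (N Q : ℕ) (hN : 1 ≤ N) (hQ : Q ∣ N) (hQcop : Nat.Coprime Q (N / Q)) :
    ∑ N' ∈ N.divisors.filter (fun d => Squarefree (N / d)),
        (moebius (Q / Nat.gcd Q N') : ℤ) * ((N' / Nat.gcd Q N' : ℕ) : ℤ) =
      if Q = 1 then ∑ d ∈ N.divisors.filter (fun d => Squarefree (N / d)), (d : ℤ)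
      else 0 := by
  split_ifs with h1
  · subst h1
    simp
  have hp := Nat.minFac_prime h1
  have hpQ := Nat.minFac_dvd Q
  generalize Q.minFac = p at hp hpQ
  have hN0 : N ≠ 0 := by omega
  have hmem : ∀ a, a ∈ N.divisors.filter (fun d => Squarefree (N / d)) ↔
      ∃ d, N = a * d ∧ Squarefree d := by
    intro a
    rw [Finset.mem_filter, Nat.mem_divisors]
    constructor
    · rintro ⟨⟨hd, -⟩, hs⟩
      exact ⟨_, (Nat.mul_div_cancel' hd).symm, hs⟩
    · rintro ⟨d, rfl, hs⟩
      refine ⟨⟨dvd_mul_right _ _, hN0⟩, ?_⟩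
      rwa [Nat.mul_div_cancel_left _ (Nat.pos_of_ne_zero (left_ne_zero_of_mul hN0))]
  have hcases : ∀ a ∈ N.divisors.filter (fun d => Squarefree (N / d)),
      (∃ e, N = p * a * e ∧ Squarefree e ∧ ¬ p ∣ e ∧ p * a ∣ N ∧ ¬ p * (p * a) ∣ N) ∨
      (∃ b e, a = p * b ∧ N = p * b * e ∧ Squarefree e ∧ ¬ p ∣ e ∧ ¬ p * a ∣ N) := by
    intro a ha
    obtain ⟨d, hd, hs⟩ := (hmem a).1 ha
    have ha0 : 0 < a := Nat.pos_of_ne_zero (by rintro rfl; simp at hd; omega)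
    by_cases hpd : p ∣ d
    · obtain ⟨e, rfl⟩ := hpd
      have hpe : ¬ p ∣ e := fun h => hp.not_isUnit (hs p (mul_dvd_mul_left p h))
      have hd' : N = p * a * e := by rw [hd]; ring
      refine Or.inl ⟨e, hd', hs.of_mul_right, hpe, ⟨e, hd'⟩, fun h => hpe ?_⟩
      rw [hd', mul_comm p (p * a)] at h
      exact Nat.dvd_of_mul_dvd_mul_left (Nat.mul_pos hp.pos ha0) h
    · obtain ⟨b, rfl⟩ := (hp.dvd_mul.1 (hd ▸ hpQ.trans hQ)).resolve_right hpd
      refine Or.inr ⟨b, d, rfl, hd, hs, hpd, fun h => hpd ?_⟩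
      rw [hd, mul_comm p (p * b)] at h
      exact Nat.dvd_of_mul_dvd_mul_left ha0 h
  have hcancel : ∀ a e, N = p * a * e → ¬ p ∣ e → _ := fun a e h he =>
    moebius_div_gcd_mul_add_eq_zero hp (a := a) (by rintro rfl; simp at h; omega) he hpQ hQcop
      (by rw [← h, Nat.mul_div_cancel' hQ])
  refine Finset.sum_involution (fun a _ => if p * a ∣ N then p * a else a / p) ?_ ?_ ?_ ?_
  · intro a ha
    obtain ⟨e, h, -, he, hd, -⟩ | ⟨b, e, rfl, h, -, he, hd⟩ := hcases a ha
    · simpa only [if_pos hd] using hcancel a e h he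
    · simp only [if_neg hd, Nat.mul_div_cancel_left _ hp.pos]
      rw [add_comm]
      exact hcancel b e h he
  · intro a ha _
    obtain ⟨e, h, -, he, hd, hd'⟩ | ⟨b, e, rfl, h, -, he, hd⟩ := hcases a ha
    · simp only [if_pos hd]
      intro h'
      rw [h'] at hd'
      exact hd' hd
    · simp only [if_neg hd, Nat.mul_div_cancel_left _ hp.pos]
      intro h'
      rw [← h'] at hd
      exact hd ⟨e, h⟩
  · intro a ha
    obtain ⟨e, h, hs, -, hd, -⟩ | ⟨b, e, rfl, h, hs, he, hd⟩ := hcases a ha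
    · simp only [if_pos hd]
      exact (hmem _).2 ⟨e, h, hs⟩
    · simp only [if_neg hd, Nat.mul_div_cancel_left _ hp.pos]
      refine (hmem _).2 ⟨p * e, by rw [h]; ring, ?_⟩
      exact (Nat.squarefree_mul ((hp.coprime_iff_not_dvd).2 he)).2 ⟨hp.prime.squarefree, hs⟩
  · intro a ha
    obtain ⟨e, h, -, -, hd, hd'⟩ | ⟨b, e, rfl, h, -, -, hd⟩ := hcases a ha
    · simp only [if_pos hd, if_neg hd', Nat.mul_div_cancel_left _ hp.pos]
    · simp only [if_neg hd, Nat.mul_div_cancel_left _ hp.pos]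
      exact if_pos ⟨e, h⟩
end

section
/- Let α be the multiplicative arithmetic function determined on prime powers by α(p) = −1, α(p²) = −1, α(p³) = 1, and α(p^r) = 0 for r ≥ 4 (with α(1) = 1), and let ψ^new(N) := Σ_{d ∣ N} α(N/d)·d. Let N ≥ 1 and let Q be an exact divisor of N. Then, as an identity of rational numbers, Σ_{N' ∣ N} α(N/N') · (N' / gcd(Q, N')) = ψ^new(N) · ∏_{p^r ∥ Q} (−𝟙[r = 2] / (p² − p − 1)). Equivalently, the sum equals 0 unless every prime power p^r exactly dividing Q has r = 2 (i.e. Q is the square of a squarefree number), in which case it equals (−1)^{ω(Q)} · ψ^new(N) / ∏_{p ∣ Q} (p² − p − 1). -/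
theorem Nat.Coprime.sum_divisors_div_mul {R : Type*} [CommSemiring R] {m n : ℕ}
    (hmn : m.Coprime n) {a f g h : ℕ → R}
    (ha : ∀ x y : ℕ, x.Coprime y → a (x * y) = a x * a y)
    (hf : ∀ d ∈ m.divisors, ∀ e ∈ n.divisors, f (d * e) = g d * h e) :
    ∑ d ∈ (m * n).divisors, a (m * n / d) * f d =
      (∑ d ∈ m.divisors, a (m / d) * g d) * ∑ e ∈ n.divisors, a (n / e) * h e := by
  rw [Nat.divisors_mul, Finset.mul_def, Finset.sum_image hmn.mul_injOn_divisors,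
    Finset.sum_product, Finset.sum_mul_sum]
  refine Finset.sum_congr rfl fun d hd => Finset.sum_congr rfl fun e he => ?_
  have hdm := Nat.dvd_of_mem_divisors hd
  have hen := Nat.dvd_of_mem_divisors he
  have hcop : (m / d).Coprime (n / e) :=
    (hmn.coprime_dvd_left (Nat.div_dvd_of_dvd hdm)).coprime_dvd_right (Nat.div_dvd_of_dvd hen)
  simp only
  rw [Nat.mul_div_mul_comm hdm hen, ha _ _ hcop, hf d hd e he]
  ring

theorem Nat.Coprime.prod_primeFactors_factorization_mul {R : Type*} [CommMonoid R] {m n : ℕ}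
    (hmn : m.Coprime n) (c : ℕ → ℕ → R) :
    ∏ p ∈ (m * n).primeFactors, c p ((m * n).factorization p) =
      (∏ p ∈ m.primeFactors, c p (m.factorization p)) *
        ∏ p ∈ n.primeFactors, c p (n.factorization p) := by
  rw [hmn.primeFactors_mul, Finset.prod_union hmn.disjoint_primeFactors]
  congr 1 <;> refine Finset.prod_congr rfl fun p hp => ?_
  · rw [Nat.factorization_eq_of_coprime_left hmn
      (Nat.mem_primeFactors_iff_mem_primeFactorsList.1 hp)]
  · rw [Nat.factorization_eq_of_coprime_right hmn
      (Nat.mem_primeFactors_iff_mem_primeFactorsList.1 hp)]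

theorem Nat.Prime.sum_divisors_pow_div {R : Type*} [AddCommMonoid R] {p : ℕ} (hp : p.Prime)
    (r : ℕ) (a : ℕ → R) :
    ∑ d ∈ (p ^ r).divisors, a (p ^ r / d) = ∑ k ∈ Finset.range (r + 1), a (p ^ k) := by
  rw [Nat.sum_div_divisors, Nat.sum_divisors_prime_pow hp]

/-- The coefficients `α (p ^ k)`, `k ≤ r`, sum to zero unless `r = 0` or `r = 2`. -/
theorem sum_range_newform_coeff_eq_zero {a : ℕ → ℚ} (h0 : a 0 = 1)
    (ha : ∀ r, 1 ≤ r → a r = if r ≤ 2 then -1 else if r = 3 then 1 else 0)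
    {r : ℕ} (hr : 0 < r) (hr2 : r ≠ 2) : ∑ k ∈ Finset.range (r + 1), a k = 0 := by
  have h1 : a 1 = -1 := by simp [ha 1]
  have h2 : a 2 = -1 := by simp [ha 2]
  have h3 : a 3 = 1 := by simp [ha 3]
  rcases (by omega : r = 1 ∨ 3 ≤ r) with rfl | h
  · simp [Finset.sum_range_succ, h0, h1]
  · induction r, h using Nat.le_induction with
    | base => simp [Finset.sum_range_succ, h0, h1, h2, h3]
    | succ n hn ih =>
      rw [Finset.sum_range_succ, ih (by omega) (by omega), ha _ (by omega),
        if_neg (by omega), if_neg (by omega), add_zero]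

theorem sum_divisors_newform_coeff {a : ℕ → ℚ} (h1 : a 1 = 1)
    (hmul : ∀ m n : ℕ, m.Coprime n → a (m * n) = a m * a n)
    (hpp : ∀ p r : ℕ, p.Prime → 1 ≤ r →
      a (p ^ r) = if r ≤ 2 then -1 else if r = 3 then 1 else 0) (Q : ℕ) (hQ : Q ≠ 0) :
    ∑ d ∈ Q.divisors, a (Q / d) * 1 =
      (∑ d ∈ Q.divisors, a (Q / d) * (d : ℚ)) *
        ∏ p ∈ Q.primeFactors,
          (-(if Q.factorization p = 2 then (1 : ℚ) else 0)) / ((p : ℚ) ^ 2 - p - 1) := by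
  induction Q using Nat.recOnPosPrimePosCoprime with
  | zero => exact absurd rfl hQ
  | one => simp [h1]
  | prime_pow p r hp hr =>
    simp only [mul_one]
    rw [hp.sum_divisors_pow_div, Nat.primeFactors_prime_pow hr.ne' hp, Finset.prod_singleton,
      hp.factorization_pow, Finsupp.single_eq_same]
    by_cases hr2 : r = 2
    · subst hr2
      have hp2 : (2 : ℚ) ≤ p := by exact_mod_cast hp.two_le
      have hne : (p : ℚ) ^ 2 - p - 1 ≠ 0 := by nlinarith
      have e1 : a p = -1 := by simpa using hpp p 1 hp le_rfl
      have e2 : a (p ^ 2) = -1 := by simpa using hpp p 2 hp (by norm_num)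
      have e3 : p ^ 2 / p = p := by rw [pow_two, Nat.mul_div_cancel _ hp.pos]
      have hF : ∑ d ∈ (p ^ 2).divisors, a (p ^ 2 / d) * (d : ℚ) = (p : ℚ) ^ 2 - p - 1 := by
        simp [Nat.sum_divisors_prime_pow hp, Finset.sum_range_succ, e1, e2, e3,
          Nat.div_self (pow_pos hp.pos 2), h1]
        ring
      rw [hF, if_pos rfl, mul_div_cancel₀ _ hne]
      simp [Finset.sum_range_succ, h1, e1, e2]
    · rw [if_neg hr2, sum_range_newform_coeff_eq_zero (a := fun k => a (p ^ k)) (by simpa using h1)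
        (fun k hk => hpp p k hp hk) hr hr2]
      simp
  | coprime m n hm hn hmn ihm ihn =>
    rw [hmn.sum_divisors_div_mul (f := fun _ => 1) (g := fun _ => 1) (h := fun _ => 1) hmul
        (by simp),
      hmn.sum_divisors_div_mul (g := fun d => (d : ℚ)) (h := fun d => (d : ℚ)) hmul (by simp),
      hmn.prod_primeFactors_factorization_mul
        (fun p r => (-(if r = 2 then (1 : ℚ) else 0)) / ((p : ℚ) ^ 2 - p - 1)),
      ihm (by omega), ihn (by omega)]
    ring

theorem stmt_3 (α : ℕ → ℤ) (hα1 : α 1 = 1)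
    (hαmult : ∀ m n : ℕ, Nat.Coprime m n → α (m * n) = α m * α n)
    (hαpp : ∀ p r : ℕ, p.Prime → 1 ≤ r →
      α (p ^ r) = if r ≤ 2 then -1 else if r = 3 then 1 else 0)
    (N Q : ℕ) (hN : 1 ≤ N) (hQ : Q ∣ N) (hQcop : Nat.Coprime Q (N / Q)) :
    ∑ N' ∈ N.divisors, (α (N / N') : ℚ) * ((N' / Nat.gcd Q N' : ℕ) : ℚ) =
      (∑ d ∈ N.divisors, (α (N / d) : ℚ) * (d : ℚ)) *
        ∏ p ∈ Q.primeFactors,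
          (-(if Q.factorization p = 2 then (1 : ℚ) else 0)) / ((p : ℚ) ^ 2 - p - 1) := by
  obtain ⟨M, rfl⟩ := hQ
  have hQ0 : Q ≠ 0 := by rintro rfl; simp at hN
  rw [Nat.mul_div_cancel_left _ (Nat.pos_of_ne_zero hQ0)] at hQcop
  have hmul : ∀ m n : ℕ, m.Coprime n → (α (m * n) : ℚ) = α m * α n := fun m n h => by
    rw [hαmult m n h, Int.cast_mul]
  have hgcd : ∀ d ∈ Q.divisors, ∀ e ∈ M.divisors,
      ((d * e / Nat.gcd Q (d * e) : ℕ) : ℚ) = 1 * (e : ℚ) := fun d hd e he => by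
    have hdQ := Nat.dvd_of_mem_divisors hd
    rw [(hQcop.coprime_dvd_right (Nat.dvd_of_mem_divisors he)).symm.gcd_mul_right_cancel_right,
      Nat.gcd_eq_right hdQ, Nat.mul_div_cancel_left _ (Nat.pos_of_mem_divisors hd), one_mul]
  rw [hQcop.sum_divisors_div_mul (a := fun n => (α n : ℚ))
      (f := fun d => ((d / Nat.gcd Q d : ℕ) : ℚ)) (g := fun _ => 1) (h := fun e => (e : ℚ))
      hmul hgcd,
    hQcop.sum_divisors_div_mul (a := fun n => (α n : ℚ)) (f := fun d => (d : ℚ))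
      (g := fun d => (d : ℚ)) (h := fun e => (e : ℚ)) hmul (by simp),
    sum_divisors_newform_coeff (a := fun n => (α n : ℚ)) (by simp [hα1]) hmul
      (fun p r hp hr => by rw [hαpp p r hp hr]; push_cast; rfl) Q hQ0]
  ring
end

section
/- Let m and Q be positive integers with gcd(m, Q) = 1. Then the number of pairs (Q', s), where Q' is a positive divisor of Q and s is an integer satisfying s² = 4·m·Q', Q' ∣ s, and gcd((s/Q')², Q/Q') squarefree, equals 2 if m is a perfect square and equals 0 otherwise. -/
lemma squarefree_gcd_four_iff (Q : ℕ) : Squarefree (Nat.gcd 4 Q) ↔ ¬ 4 ∣ Q := by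
  constructor
  · intro h h4
    rw [Nat.gcd_eq_left h4] at h
    have := Nat.isUnit_iff.1 (h 2 (by norm_num))
    omega
  · intro h
    have hd : Nat.gcd 4 Q ∣ 2 ^ 2 := Nat.gcd_dvd_left 4 Q
    obtain ⟨i, hi, he⟩ := (Nat.dvd_prime_pow Nat.prime_two).1 hd
    interval_cases i
    · simp [he]
    · rw [he, pow_one]
      exact Nat.prime_two.prime.squarefree
    · have := Nat.gcd_dvd_right 4 Q
      rw [he] at this
      exact absurd this h

/-- A divisor `q` of `Q` with `4 * m = q * t ^ 2` is `1` or `4` when `m` is prime to `Q`. -/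
lemma eq_one_or_four_of_mul_sq_eq {m Q q : ℕ} (hcop : Nat.Coprime m Q) (hq : q ∣ Q) {t : ℤ}
    (ht : (q : ℤ) * t ^ 2 = 4 * m) : q = 1 ∨ q = 4 := by
  have hqm : Nat.Coprime q m := (hcop.coprime_dvd_right hq).symm
  have hdvd : q ∣ 4 * m := by
    have : (q : ℤ) ∣ ((4 * m : ℕ) : ℤ) := ⟨t ^ 2, by push_cast; exact ht.symm⟩
    exact_mod_cast this
  have h4 : q ∣ 2 ^ 2 := hqm.dvd_of_dvd_mul_right hdvd
  obtain ⟨i, hi, rfl⟩ := (Nat.dvd_prime_pow Nat.prime_two).1 h4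
  interval_cases i
  · simp
  · exfalso
    push_cast at ht
    have ht' : t ^ 2 = 2 * m := by linarith
    have h2t : (2 : ℤ) ∣ t := Int.prime_two.dvd_of_dvd_pow ⟨_, ht'⟩
    obtain ⟨u, rfl⟩ := h2t
    have hm : (2 : ℤ) ∣ m := ⟨u ^ 2, by linarith⟩
    have hm' : 2 ∣ m := by exact_mod_cast hm
    have := Nat.dvd_gcd (by norm_num : 2 ∣ 2 ^ 1) hm'
    rw [hqm] at this
    omega
  · simp

lemma discriminant_zero_pair_iff {m Q : ℕ} (hcop : Nat.Coprime m Q) (q : ℕ) (s : ℤ) :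
    (q ∣ Q ∧ s ^ 2 = 4 * (m : ℤ) * (q : ℤ) ∧ (q : ℤ) ∣ s ∧
      Squarefree (Int.gcd ((s / (q : ℤ)) ^ 2) ((Q / q : ℕ) : ℤ))) ↔
    q = (if 4 ∣ Q then 4 else 1) ∧ s ^ 2 = 4 * (m : ℤ) * (q : ℤ) := by
  have one_iff (hs : s ^ 2 = 4 * (m : ℤ)) :
      Squarefree (Int.gcd (s ^ 2) (Q : ℤ)) ↔ ¬ 4 ∣ Q := by
    have : Int.gcd (s ^ 2) (Q : ℤ) = Nat.gcd 4 Q := by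
      rw [hs, show (4 * (m : ℤ)) = ((4 * m : ℕ) : ℤ) by push_cast; ring, Int.gcd_natCast_natCast]
      exact hcop.gcd_mul_right_cancel 4
    rw [this, squarefree_gcd_four_iff]
  constructor
  · rintro ⟨hq, hs, ⟨t, rfl⟩, hsq⟩
    refine ⟨?_, hs⟩
    rcases Nat.eq_zero_or_pos q with rfl | hpos
    · obtain rfl : Q = 0 := by simpa using hq
      simp at hsq
    have ht : (q : ℤ) * t ^ 2 = 4 * m := by
      have : (q : ℤ) ≠ 0 := by positivity
      apply mul_left_cancel₀ this
      linarith
    rcases eq_one_or_four_of_mul_sq_eq hcop hq ht with rfl | rfl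
    · rw [if_neg]
      exact (one_iff (by simpa using hs)).1 (by simpa using hsq)
    · rw [if_pos hq]
  · rintro ⟨hq, hs⟩
    split_ifs at hq with h4
    · subst hq
      push_cast at hs ⊢
      have h4s : (4 : ℤ) ∣ s :=
        (Int.pow_dvd_pow_iff two_ne_zero).1 ⟨m, by linarith⟩
      obtain ⟨t, rfl⟩ := h4s
      refine ⟨h4, hs, dvd_mul_right _ _, ?_⟩
      have ht : t ^ 2 = m := by linarith
      have hc : Nat.gcd m (Q / 4) = 1 := hcop.coprime_dvd_right (Nat.div_dvd_of_dvd h4)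
      rw [Int.mul_ediv_cancel_left _ (by norm_num), ht]
      have : Int.gcd (m : ℤ) ((Q : ℤ) / 4) = 1 := by exact_mod_cast hc
      rw [this]
      exact squarefree_one
    · subst hq
      have := (one_iff (by simpa using hs)).2 h4
      exact ⟨one_dvd _, hs, by simp, by simpa using this⟩

theorem stmt_6 (m Q : ℕ) (hm : 0 < m) (hQ : 0 < Q) (hcop : Nat.Coprime m Q) :
    Nat.card {x : ℕ × ℤ // x.1 ∣ Q ∧ x.2 ^ 2 = 4 * (m : ℤ) * (x.1 : ℤ) ∧
        (x.1 : ℤ) ∣ x.2 ∧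
        Squarefree (Int.gcd ((x.2 / (x.1 : ℤ)) ^ 2) ((Q / x.1 : ℕ) : ℤ))} =
      if IsSquare m then 2 else 0 := by
  simp_rw [discriminant_zero_pair_iff hcop]
  obtain ⟨r, hr, hc⟩ : ∃ r : ℕ, 0 < r ∧ (if 4 ∣ Q then 4 else 1) = r ^ 2 := by
    split_ifs
    · exact ⟨2, by norm_num⟩
    · exact ⟨1, by norm_num⟩
  rw [hc]
  split_ifs with hsq
  · obtain ⟨k, rfl⟩ := hsq
    have hk : 0 < k := Nat.pos_of_mul_pos_left hm
    have hpos : (0 : ℤ) < 2 * k * r := by positivity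
    have hset : {x : ℕ × ℤ | x.1 = r ^ 2 ∧ x.2 ^ 2 = 4 * ((k * k : ℕ) : ℤ) * (x.1 : ℤ)} =
        {(r ^ 2, 2 * (k : ℤ) * r), (r ^ 2, -(2 * (k : ℤ) * r))} := by
      ext ⟨q, s⟩
      simp only [Set.mem_ofPred_eq, Set.mem_insert_iff, Set.mem_singleton_iff, Prod.mk.injEq,
        ← and_or_left, ← sq_eq_sq_iff_eq_or_eq_neg]
      refine and_congr_right ?_
      rintro rfl
      push_cast
      ring_nf
    change Set.ncard {x : ℕ × ℤ | x.1 = r ^ 2 ∧ x.2 ^ 2 = 4 * ((k * k : ℕ) : ℤ) * (x.1 : ℤ)} = 2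
    rw [hset, Set.ncard_pair]
    simp only [ne_eq, Prod.mk.injEq, true_and]
    omega
  · rw [Nat.card_eq_zero]
    refine Or.inl ⟨?_⟩
    rintro ⟨⟨q, s⟩, hq, hs⟩
    dsimp only at hq hs
    subst hq
    have hdvd : (2 * r : ℤ) ∣ s :=
      (Int.pow_dvd_pow_iff two_ne_zero).1 ⟨m, by push_cast at hs; linarith⟩
    obtain ⟨t, rfl⟩ := hdvd
    have hr' : (4 * r ^ 2 : ℤ) ≠ 0 := by positivity
    have ht : t ^ 2 = m := by
      apply mul_left_cancel₀ hr'
      push_cast at hs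
      linarith
    refine hsq ⟨t.natAbs, ?_⟩
    zify
    rw [← ht, ← sq, sq_abs]
end

section
/- Let N ≥ 1 be a natural number and let σ be a sign pattern for N such that it is NOT the case that 4 exactly divides N and σ(4) = +1. Then 0.71546 ≤ ∏_{p^r ∥ N} (1 + σ(p^r)·(−𝟙[r = 2])/(p² − p − 1)) ≤ 2.67412, where the product runs over all prime powers p^r exactly dividing N. -/
/-- `Q` exactly divides `N`: `Q ∣ N` and `gcd(Q, N/Q) = 1`. -/
def ExactlyDivides (Q N : ℕ) : Prop := Q ∣ N ∧ Nat.Coprime Q (N / Q)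

/-- A sign pattern for `N`: an integer-valued function on the exact divisors of `N` with
`σ 1 = 1`, multiplicative on coprime exact divisors, taking values `±1` on
prime powers exactly dividing `N`. -/
def IsSignPattern (N : ℕ) (σ : ℕ → ℤ) : Prop :=
  σ 1 = 1 ∧
  (∀ Q₁ Q₂ : ℕ, ExactlyDivides Q₁ N → ExactlyDivides Q₂ N → Nat.Coprime Q₁ Q₂ →
    σ (Q₁ * Q₂) = σ Q₁ * σ Q₂) ∧
  (∀ p r : ℕ, p.Prime → 1 ≤ r → ExactlyDivides (p ^ r) N →
    σ (p ^ r) = 1 ∨ σ (p ^ r) = -1)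

/-- Sieve by the primes up to `29`: keeps every prime, and keeps no composite number
below `31 ^ 2`. -/
def sieve (n : ℕ) : Bool :=
  [2, 3, 5, 7, 11, 13, 17, 19, 23, 29].contains n || (decide (2 ≤ n) && n.gcd 6469693230 == 1)

lemma sieve_of_prime {p : ℕ} (hp : p.Prime) : sieve p = true := by
  by_cases h : p ∣ 6469693230
  · have h' : p ∣ 2 * 3 * 5 * 7 * 11 * 13 * 17 * 19 * 23 * 29 := by simpa using h
    simp only [hp.dvd_mul] at h'
    have key {q : ℕ} (hq : q.Prime) : p ∣ q ↔ p = q := Nat.prime_dvd_prime_iff_eq hp hq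
    rw [key (by norm_num), key (by norm_num), key (by norm_num), key (by norm_num),
      key (by norm_num), key (by norm_num), key (by norm_num), key (by norm_num),
      key (by norm_num), key (by norm_num)] at h'
    simp only [sieve, Bool.or_eq_true, List.contains_iff_mem, List.mem_cons]
    tauto
  · have h' := (Nat.Prime.coprime_iff_not_dvd hp).2 h
    simp [sieve, hp.two_le, Nat.coprime_iff_gcd_eq_one.1 h']

lemma two_le_of_sieve {n : ℕ} (h : sieve n = true) : 2 ≤ n := by
  simp only [sieve, Bool.or_eq_true, List.contains_iff_mem, List.mem_cons, Bool.and_eq_true,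
    decide_eq_true_eq] at h
  grind

/-- Equals `(1 + 1 / (n ^ 2 - n - 1)) * (1 - 1 / n ^ 2)` on the sieve. -/
def upperFactor (n : ℕ) : ℚ :=
  if sieve n then 1 + 1 / (n * (n ^ 2 - n - 1)) else 1

/-- Equals `(1 - 1 / (n ^ 2 - n - 1)) / (1 - 1 / n ^ 2)` on the sieve, away from `2`. -/
def lowerFactor (n : ℕ) : ℚ :=
  if sieve n && decide (n ≠ 2) then 1 - 1 / (n ^ 2 * (n - 2) + 1) else 1

lemma one_le_upperFactor (n : ℕ) : 1 ≤ upperFactor n := by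
  unfold upperFactor
  split_ifs with h
  · have h2 : (2 : ℚ) ≤ n := by exact_mod_cast two_le_of_sieve h
    have : (0 : ℚ) < n * (n ^ 2 - n - 1) := mul_pos (by linarith) (by nlinarith)
    have := one_div_pos.2 this
    linarith
  · rfl

lemma lowerFactor_nonneg_le_one (n : ℕ) : 0 ≤ lowerFactor n ∧ lowerFactor n ≤ 1 := by
  unfold lowerFactor
  split_ifs with h
  · have h2 : (2 : ℚ) ≤ n := by
      exact_mod_cast two_le_of_sieve (by simp at h; exact h.1)
    have h1 : (1 : ℚ) ≤ n ^ 2 * (n - 2) + 1 := by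
      have : (0 : ℚ) ≤ n ^ 2 * (n - 2) := mul_nonneg (by positivity) (by linarith)
      linarith
    have h3 : 1 / ((n : ℚ) ^ 2 * (n - 2) + 1) ≤ 1 := by
      rw [div_le_one (by linarith)]; exact h1
    have h4 : 0 < 1 / ((n : ℚ) ^ 2 * (n - 2) + 1) := one_div_pos.2 (by linarith)
    constructor <;> linarith
  · simp

lemma prod_upperFactor_range_961 :
    (∏ n ∈ Finset.range 961, upperFactor n) * (1 + 1 / (2 * 959 ^ 2)) ≤ 1.625669 := by
  decide +kernel

lemma prod_lowerFactor_range_961 :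
    0.88267 ≤ (∏ n ∈ Finset.range 961, lowerFactor n) * (1 - 1 / (2 * 959 ^ 2)) := by
  decide +kernel

lemma upper_telescope {t : ℚ} (ht : 3 ≤ t) :
    (1 + 1 / ((t + 2) * ((t + 2) ^ 2 - (t + 2) - 1))) * (1 + 1 / (2 * (t + 1) ^ 2)) ≤
      1 + 1 / (2 * t ^ 2) := by
  obtain ⟨s, rfl⟩ : ∃ s, t = s + 3 := ⟨t - 3, by ring⟩
  have hs : 0 ≤ s := by linarith
  have h : (s + 3 + 2) ^ 2 - (s + 3 + 2) - 1 = s ^ 2 + 9 * s + 19 := by ring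
  rw [h, ← sub_nonneg]
  field_simp
  ring_nf
  positivity

lemma lower_telescope {t : ℚ} (ht : 3 ≤ t) :
    1 - 1 / (2 * t ^ 2) ≤
      (1 - 1 / ((t + 2) ^ 2 * t + 1)) * (1 - 1 / (2 * (t + 1) ^ 2)) := by
  obtain ⟨s, rfl⟩ : ∃ s, t = s + 3 := ⟨t - 3, by ring⟩
  have hs : 0 ≤ s := by linarith
  rw [← sub_nonneg]
  field_simp
  ring_nf
  positivity

lemma prod_upperFactor_range_le {m : ℕ} (hm : 961 ≤ m) :
    (∏ n ∈ Finset.range m, upperFactor n) * (1 + 1 / (2 * ((m : ℚ) - 2) ^ 2)) ≤ 1.625669 := by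
  induction m, hm using Nat.le_induction with
  | base => convert prod_upperFactor_range_961 using 3; norm_num
  | succ m hm ih =>
    refine le_trans ?_ ih
    rw [Finset.prod_range_succ, mul_assoc]
    refine mul_le_mul_of_nonneg_left ?_
      (Finset.prod_nonneg fun n _ => zero_le_one.trans (one_le_upperFactor n))
    have hm' : (961 : ℚ) ≤ m := by exact_mod_cast hm
    have ht := upper_telescope (t := (m : ℚ) - 2) (by linarith)
    rw [sub_add_cancel] at ht
    refine le_trans ?_ ht
    have hc : ((m + 1 : ℕ) : ℚ) - 2 = (m : ℚ) - 2 + 1 := by push_cast; ring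
    rw [hc]
    refine mul_le_mul_of_nonneg_right ?_ (by positivity)
    unfold upperFactor
    split_ifs
    · rfl
    · have : (0 : ℚ) < m * (m ^ 2 - m - 1) := mul_pos (by linarith) (by nlinarith)
      have := one_div_pos.2 this
      linarith

lemma le_prod_lowerFactor_range {m : ℕ} (hm : 961 ≤ m) :
    0.88267 ≤ (∏ n ∈ Finset.range m, lowerFactor n) * (1 - 1 / (2 * ((m : ℚ) - 2) ^ 2)) := by
  induction m, hm using Nat.le_induction with
  | base => convert prod_lowerFactor_range_961 using 3; norm_num
  | succ m hm ih =>
    refine ih.trans ?_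
    rw [Finset.prod_range_succ, mul_assoc]
    refine mul_le_mul_of_nonneg_left ?_
      (Finset.prod_nonneg fun n _ => (lowerFactor_nonneg_le_one n).1)
    have hm' : (961 : ℚ) ≤ m := by exact_mod_cast hm
    have ht := lower_telescope (t := (m : ℚ) - 2) (by linarith)
    rw [sub_add_cancel] at ht
    refine ht.trans ?_
    have hc : ((m + 1 : ℕ) : ℚ) - 2 = (m : ℚ) - 2 + 1 := by push_cast; ring
    rw [hc]
    refine mul_le_mul_of_nonneg_right ?_ ?_
    · unfold lowerFactor
      split_ifs
      · rfl
      · have : (0 : ℚ) < m ^ 2 * (m - 2) + 1 := by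
          have : (0 : ℚ) < m - 2 := by linarith
          positivity
        have := one_div_pos.2 this
        linarith
    · rw [sub_nonneg, div_le_one (by nlinarith)]
      nlinarith

lemma prod_upperFactor_le (s : Finset ℕ) : ∏ n ∈ s, upperFactor n ≤ 1.625669 := by
  have hm := prod_upperFactor_range_le (m := 961 + s.sup id + 1) (by omega)
  have hs : s ⊆ Finset.range (961 + s.sup id + 1) := fun n hn => by
    have : n ≤ s.sup id := Finset.le_sup (f := id) hn
    simp; omega
  have h0 (t : Finset ℕ) : 0 ≤ ∏ n ∈ t, upperFactor n :=
    Finset.prod_nonneg fun n _ => zero_le_one.trans (one_le_upperFactor n)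
  refine (Finset.prod_le_prod_of_subset_of_one_le hs (fun n _ => ?_) fun n _ _ => ?_).trans
    ((le_mul_of_one_le_right (h0 _) ?_).trans hm)
  · exact zero_le_one.trans (one_le_upperFactor n)
  · exact one_le_upperFactor n
  · exact le_add_of_nonneg_right (by positivity)

lemma le_prod_lowerFactor (s : Finset ℕ) : 0.88267 ≤ ∏ n ∈ s, lowerFactor n := by
  have hm := le_prod_lowerFactor_range (m := 961 + s.sup id + 1) (by omega)
  have hs : s ⊆ Finset.range (961 + s.sup id + 1) := fun n hn => by
    have : n ≤ s.sup id := Finset.le_sup (f := id) hn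
    simp; omega
  have h0 (t : Finset ℕ) : 0 ≤ ∏ n ∈ t, lowerFactor n :=
    Finset.prod_nonneg fun n _ => (lowerFactor_nonneg_le_one n).1
  refine (hm.trans (mul_le_of_le_one_right (h0 _) ?_)).trans
    (Finset.prod_le_prod_of_subset_of_le_one hs (fun n _ => ?_) fun n _ _ => ?_)
  · exact sub_le_self _ (by positivity)
  · exact (lowerFactor_nonneg_le_one n).1
  · exact (lowerFactor_nonneg_le_one n).2

open Real in
lemma le_prod_one_sub_inv_sq {s : Finset ℕ} (hs : ∀ p ∈ s, p.Prime) :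
    6 / π ^ 2 ≤ ∏ p ∈ s, (1 - ((p : ℝ) ^ 2)⁻¹) := by
  let f : ℕ →* ℝ :=
    { toFun := fun n => ((n : ℝ) ^ 2)⁻¹
      map_one' := by simp
      map_mul' := fun a b => by push_cast; rw [mul_pow, mul_inv] }
  have hz : HasSum f (π ^ 2 / 6) := by simpa [f] using hasSum_zeta_two
  have h := EulerProduct.prod_filter_prime_geometric_eq_tsum_factoredNumbers hz.summable s
  rw [Finset.filter_true_of_mem hs, Finset.prod_inv_distrib] at h
  have hle : ∑' m : Nat.factoredNumbers s, f m ≤ π ^ 2 / 6 :=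
    hz.tsum_eq ▸ hz.summable.tsum_subtype_le _ _ fun n =>
      show (0 : ℝ) ≤ ((n : ℝ) ^ 2)⁻¹ by positivity
  have hpos : 0 < ∏ p ∈ s, (1 - f p) := Finset.prod_pos fun p hp => by
    have := hz.summable.norm_lt_one (hs p hp).one_lt
    linarith [le_abs_self (f p), Real.norm_eq_abs (f p)]
  rw [← h] at hle
  have := inv_le_of_inv_le₀ hpos hle
  rwa [inv_div] at this

lemma mul_one_sub_inv_sq_eq_upperFactor {p : ℕ} (hp : p.Prime) :
    (1 + 1 / ((p : ℝ) ^ 2 - p - 1)) * (1 - ((p : ℝ) ^ 2)⁻¹) = (upperFactor p : ℝ) := by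
  have h2 : (2 : ℝ) ≤ p := by exact_mod_cast hp.two_le
  have : (p : ℝ) * (p - 1) - 1 ≠ 0 := by nlinarith
  rw [upperFactor, if_pos (sieve_of_prime hp)]
  push_cast
  rw [show (p : ℝ) ^ 2 - p - 1 = p * (p - 1) - 1 by ring]
  field_simp
  ring

lemma one_sub_inv_sq_mul_lowerFactor {p : ℕ} (hp : p.Prime) (hne : p ≠ 2) :
    (1 - ((p : ℝ) ^ 2)⁻¹) * (lowerFactor p : ℝ) = 1 - 1 / ((p : ℝ) ^ 2 - p - 1) := by
  have h2 : (2 : ℝ) ≤ p := by exact_mod_cast hp.two_le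
  have h1 : (p : ℝ) * (p - 1) - 1 ≠ 0 := by nlinarith
  have h3 : (p : ℝ) - 1 ≠ 0 := by linarith
  have h4 : (p : ℝ) ^ 2 * (p - 2) + 1 ≠ 0 := by
    have : (0 : ℝ) ≤ p - 2 := by linarith
    positivity
  rw [lowerFactor, if_pos (by simp [sieve_of_prime hp, hne]),
    show (p : ℝ) ^ 2 - p - 1 = p * (p - 1) - 1 by ring]
  push_cast
  field_simp
  ring

lemma six_div_pi_sq_gt : 0.6079271 < 6 / Real.pi ^ 2 := by
  rw [lt_div_iff₀ (by positivity)]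
  nlinarith [Real.pi_lt_d20, Real.pi_pos]

lemma prod_one_add_le {s : Finset ℕ} (hs : ∀ p ∈ s, p.Prime) :
    ∏ p ∈ s, (1 + 1 / ((p : ℝ) ^ 2 - p - 1)) ≤ 2.67412 := by
  have h := Finset.prod_congr rfl fun p hp => mul_one_sub_inv_sq_eq_upperFactor (hs p hp)
  rw [Finset.prod_mul_distrib] at h
  have hU : ∏ p ∈ s, (upperFactor p : ℝ) ≤ 1.625669 := by
    have := (Rat.cast_le (K := ℝ)).2 (prod_upperFactor_le s)
    push_cast at this
    norm_num at this ⊢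
    exact this
  have hz := le_prod_one_sub_inv_sq hs
  have h0 : 0 ≤ ∏ p ∈ s, (1 + 1 / ((p : ℝ) ^ 2 - p - 1)) := Finset.prod_nonneg fun p hp => by
    have h2 : (2 : ℝ) ≤ p := by exact_mod_cast (hs p hp).two_le
    have : (0 : ℝ) < (p : ℝ) ^ 2 - p - 1 := by nlinarith
    positivity
  have := mul_le_mul_of_nonneg_left (six_div_pi_sq_gt.le.trans hz) h0
  linarith

lemma le_prod_one_sub {s : Finset ℕ} (hs : ∀ p ∈ s, p.Prime) (h2 : 2 ∉ s) :
    0.71546 ≤ ∏ p ∈ s, (1 - 1 / ((p : ℝ) ^ 2 - p - 1)) := by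
  have h := Finset.prod_congr rfl fun p hp =>
    one_sub_inv_sq_mul_lowerFactor (hs p hp) (ne_of_mem_of_not_mem hp h2)
  rw [Finset.prod_mul_distrib] at h
  have hL : 0.88267 ≤ ∏ p ∈ s, (lowerFactor p : ℝ) := by
    have := (Rat.cast_le (K := ℝ)).2 (le_prod_lowerFactor s)
    push_cast at this
    norm_num at this ⊢
    exact this
  have hz := le_prod_one_sub_inv_sq (s := insert 2 s) (by simpa [Nat.prime_two] using hs)
  rw [Finset.prod_insert h2] at hz
  have hz' : 0.8105694 ≤ ∏ p ∈ s, (1 - ((p : ℝ) ^ 2)⁻¹) := by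
    have := six_div_pi_sq_gt.le.trans hz
    norm_num at this ⊢
    linarith
  have := mul_le_mul hz' hL (by norm_num) (by linarith)
  linarith


lemma exactlyDivides_pow_factorization {N p : ℕ} (hN : N ≠ 0) (hp : p.Prime) :
    ExactlyDivides (p ^ N.factorization p) N :=
  ⟨Nat.ordProj_dvd N p, (Nat.coprime_ordCompl hp hN).pow_left _⟩

theorem stmt_8 (N : ℕ) (hN : 1 ≤ N) (σ : ℕ → ℤ) (hσ : IsSignPattern N σ)
    (h4 : ¬ (ExactlyDivides 4 N ∧ σ 4 = 1)) :
    0.71546 ≤ (∏ p ∈ N.primeFactors,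
        (1 + (σ (p ^ N.factorization p) : ℝ) *
          (-(if N.factorization p = 2 then (1 : ℝ) else 0)) / ((p : ℝ) ^ 2 - p - 1))) ∧
    (∏ p ∈ N.primeFactors,
        (1 + (σ (p ^ N.factorization p) : ℝ) *
          (-(if N.factorization p = 2 then (1 : ℝ) else 0)) / ((p : ℝ) ^ 2 - p - 1)))
      ≤ 2.67412 := by
  have hprime : ∀ p ∈ N.primeFactors, p.Prime := fun p hp => Nat.prime_of_mem_primeFactors hp
  have hx : ∀ p ∈ N.primeFactors, 0 < 1 / ((p : ℝ) ^ 2 - p - 1) := fun p hp => by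
    have h2 : (2 : ℝ) ≤ p := by exact_mod_cast (hprime p hp).two_le
    exact one_div_pos.2 (by nlinarith)
  have hx_odd : ∀ p ∈ N.primeFactors, p ≠ 2 → 1 / ((p : ℝ) ^ 2 - p - 1) ≤ 1 := fun p hp hne => by
    have h3 : (3 : ℝ) ≤ p := by
      exact_mod_cast lt_of_le_of_ne (hprime p hp).two_le hne.symm
    rw [div_le_one (by nlinarith)]
    nlinarith
  set t : ℕ → ℝ := fun p => 1 + (σ (p ^ N.factorization p) : ℝ) *
    (-(if N.factorization p = 2 then (1 : ℝ) else 0)) / ((p : ℝ) ^ 2 - p - 1) with ht_def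
  have ht : ∀ p ∈ N.primeFactors, t p = 1 - 1 / ((p : ℝ) ^ 2 - p - 1) ∧ p ≠ 2 ∨
      t p = 1 ∨ t p = 1 + 1 / ((p : ℝ) ^ 2 - p - 1) := fun p hp => by
    simp only [ht_def]
    have hd := exactlyDivides_pow_factorization (by omega) (hprime p hp) (N := N)
    by_cases h : N.factorization p = 2
    · rw [h] at hd ⊢
      rcases hσ.2.2 p 2 (hprime p hp) one_le_two hd with h1 | h1
      · refine Or.inl ⟨by rw [h1]; simp; ring, ?_⟩
        rintro rfl
        exact h4 ⟨hd, h1⟩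
      · exact Or.inr (Or.inr (by rw [h1]; simp))
    · exact Or.inr (Or.inl (by simp [h]))
  have ht_ge : ∀ p ∈ N.primeFactors.erase 2, 1 - 1 / ((p : ℝ) ^ 2 - p - 1) ≤ t p := fun p hp => by
    have := hx p (Finset.mem_of_mem_erase hp)
    rcases ht p (Finset.mem_of_mem_erase hp) with ⟨h, -⟩ | h | h <;> linarith
  have hodd_nonneg : ∀ p ∈ N.primeFactors.erase 2, 0 ≤ 1 - 1 / ((p : ℝ) ^ 2 - p - 1) :=
    fun p hp => sub_nonneg.2
      (hx_odd p (Finset.mem_of_mem_erase hp) (Finset.ne_of_mem_erase hp))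
  have ht_two : 2 ∈ N.primeFactors → 1 ≤ t 2 := fun hp => by
    have := hx 2 hp
    rcases ht 2 hp with ⟨-, h⟩ | h | h
    · exact absurd rfl h
    · exact h.ge
    · linarith
  have ht_nonneg : ∀ p ∈ N.primeFactors, 0 ≤ t p := fun p hp => by
    by_cases h : p = 2
    · subst h
      exact zero_le_one.trans (ht_two hp)
    · have hp' := Finset.mem_erase.2 ⟨h, hp⟩
      exact (hodd_nonneg p hp').trans (ht_ge p hp')
  constructor
  · refine (le_prod_one_sub (s := N.primeFactors.erase 2)
      (fun p hp => hprime p (Finset.mem_of_mem_erase hp)) (by simp)).trans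
      ((Finset.prod_le_prod hodd_nonneg ht_ge).trans ?_)
    by_cases h : 2 ∈ N.primeFactors
    · rw [← Finset.mul_prod_erase _ _ h]
      exact le_mul_of_one_le_left (Finset.prod_nonneg fun p hp =>
        ht_nonneg p (Finset.mem_of_mem_erase hp)) (ht_two h)
    · rw [Finset.erase_eq_of_notMem h]
  · refine (Finset.prod_le_prod ht_nonneg fun p hp => ?_).trans (prod_one_add_le hprime)
    have := hx p hp
    rcases ht p hp with ⟨h, -⟩ | h | h <;> linarith
end

section
/- The infinite products over primes A := ∏_{p prime, p ≠ 2} (1 − 1/(p² − p − 1)) and B := ∏_{p prime} (1 + 1/(p² − p − 1)) converge (are multipliable), and satisfy 0.71546 ≤ A and B ≤ 2.67412. -/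
theorem tendsto_prod_range_filter {P : ℕ → Prop} [DecidablePred P] {f : ℕ → ℝ}
    (hf : Multipliable (fun n : {n : ℕ // P n} => f n)) :
    Filter.Tendsto (fun M => ∏ n ∈ (Finset.range M).filter P, f n) Filter.atTop
      (nhds (∏' n : {n : ℕ // P n}, f n)) := by
  have h := hf.hasProd
  have h' := (hasProd_subtype_iff_mulIndicator (s := {n | P n}) (f := f)).1 h
  convert h'.tendsto_prod_nat using 2 with M
  rw [Finset.prod_filter]
  exact Finset.prod_congr rfl fun n _ => by simp [Set.mulIndicator]

theorem summable_one_div_sq_sub_sub {P : ℕ → Prop} (hP : ∀ n, P n → n.Prime) :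
    Summable (fun p : {p : ℕ // P p} => 1 / (((p : ℕ) : ℝ) ^ 2 - ((p : ℕ) : ℝ) - 1)) := by
  have h : Summable (fun p : {p : ℕ // P p} => 4 * (1 / ((p : ℕ) : ℝ) ^ 2)) :=
    (hasSum_zeta_two.summable.comp_injective Subtype.val_injective).mul_left 4
  refine Summable.of_nonneg_of_le (fun p => ?_) (fun p => ?_) h
  · have : (2 : ℝ) ≤ (p : ℕ) := mod_cast (hP p p.2).two_le
    have : (0 : ℝ) < ((p : ℕ) : ℝ) ^ 2 - ((p : ℕ) : ℝ) - 1 := by nlinarith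
    positivity
  · have : (2 : ℝ) ≤ (p : ℕ) := mod_cast (hP p p.2).two_le
    have : (0 : ℝ) < ((p : ℕ) : ℝ) ^ 2 - ((p : ℕ) : ℝ) - 1 := by nlinarith
    rw [mul_one_div, div_le_div_iff₀ (by positivity) (by positivity)]
    nlinarith

theorem prod_primesBelow_inv_one_sub_sq_le (M : ℕ) :
    ∏ p ∈ M.primesBelow, (1 - 1 / (p : ℝ) ^ 2)⁻¹ ≤ Real.pi ^ 2 / 6 := by
  let f : ℕ →* ℝ :=
    { toFun := fun n => 1 / (n : ℝ) ^ 2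
      map_one' := by simp
      map_mul' := fun a b => by push_cast; rw [mul_pow, one_div_mul_one_div] }
  have hf : ∀ {p : ℕ}, p.Prime → ‖f p‖ < 1 := fun {p} hp => by
    have : (2 : ℝ) ≤ p := mod_cast hp.two_le
    change ‖1 / (p : ℝ) ^ 2‖ < 1
    rw [Real.norm_of_nonneg (by positivity), div_lt_one (by positivity)]
    nlinarith
  have h := (EulerProduct.summable_and_hasSum_smoothNumbers_prod_primesBelow_geometric hf M).2
  exact hasSum_le_inj (fun m : M.smoothNumbers => (m : ℕ)) Subtype.val_injective
    (fun c _ => one_div_nonneg.2 (sq_nonneg (c : ℝ))) (fun m => le_rfl) h hasSum_zeta_two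

theorem prod_primesBelow_int_le :
    (∏ n ∈ Nat.primesBelow 600, ((n : ℤ) ^ 3 - n ^ 2 - n + 1)) * (1000000 * (2 * 599 ^ 2)) ≤
      1625669 * (2 * 599 ^ 2 - 1) * ∏ n ∈ Nat.primesBelow 600, ((n : ℤ) ^ 3 - n ^ 2 - n) := by
  decide +kernel

theorem le_prod_primesBelow_ne_two_int :
    88267 * (2 * 598 ^ 2 + 1) *
        ∏ n ∈ (Nat.primesBelow 600).filter (· ≠ 2), ((n : ℤ) ^ 3 - 2 * n ^ 2 + 1) ≤
      (∏ n ∈ (Nat.primesBelow 600).filter (· ≠ 2), ((n : ℤ) ^ 3 - 2 * n ^ 2)) *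
        (100000 * (2 * 598 ^ 2)) := by
  decide +kernel

theorem prod_primesBelow_one_add_le {M : ℕ} (hM : 600 ≤ M) :
    ∏ p ∈ M.primesBelow, (1 + 1 / ((p : ℝ) ^ 3 - p ^ 2 - p)) ≤
      1.625669 * (1 - 1 / (2 * ((M : ℝ) - 1) ^ 2)) := by
  induction M, hM using Nat.le_induction with
  | base =>
    have hpos : ∀ p ∈ Nat.primesBelow 600, (0 : ℝ) < (p : ℝ) ^ 3 - p ^ 2 - p := fun p hp => by
      have : (2 : ℝ) ≤ p := mod_cast Nat.two_le_of_mem_primesBelow hp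
      nlinarith [mul_pos (show (0 : ℝ) < p by linarith) (show (0 : ℝ) < p ^ 2 - p - 1 by nlinarith)]
    have e : ∏ p ∈ Nat.primesBelow 600, (1 + 1 / ((p : ℝ) ^ 3 - p ^ 2 - p)) =
        (∏ p ∈ Nat.primesBelow 600, ((p : ℝ) ^ 3 - p ^ 2 - p + 1)) /
          ∏ p ∈ Nat.primesBelow 600, ((p : ℝ) ^ 3 - p ^ 2 - p) := by
      rw [← Finset.prod_div_distrib]
      refine Finset.prod_congr rfl fun p hp => ?_
      have := (hpos p hp).ne'
      rw [add_div, div_self this]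
    have h : ((_ : ℤ) : ℝ) ≤ ((_ : ℤ) : ℝ) := Int.cast_le.2 prod_primesBelow_int_le
    push_cast at h
    rw [e, div_le_iff₀ (Finset.prod_pos hpos)]
    generalize ∏ p ∈ Nat.primesBelow 600, ((p : ℝ) ^ 3 - p ^ 2 - p + 1) = x at *
    generalize ∏ p ∈ Nat.primesBelow 600, ((p : ℝ) ^ 3 - p ^ 2 - p) = y at *
    norm_num at h ⊢
    linarith
  | succ n hn ih =>
    have hn' : (600 : ℝ) ≤ n := mod_cast hn
    have hq : (0 : ℝ) < (n : ℝ) ^ 2 - n - 1 := by nlinarith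
    have hd : (0 : ℝ) < (n : ℝ) ^ 3 - n ^ 2 - n := by
      nlinarith [mul_pos (show (0 : ℝ) < n by linarith) hq]
    have h1 : (0 : ℝ) < n - 1 := by linarith
    have key : 1 / ((n : ℝ) ^ 3 - n ^ 2 - n) ≤
        1 / (2 * ((n : ℝ) - 1) ^ 2) - 1 / (2 * (n : ℝ) ^ 2) := by
      rw [div_sub_div _ _ (by positivity) (by positivity),
        div_le_div_iff₀ hd (by positivity), ← sub_nonneg]
      have : (0 : ℝ) ≤ 2 * n * ((n : ℝ) ^ 2 - 3 * n + 1) :=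
        mul_nonneg (by linarith) (by nlinarith)
      ring_nf
      ring_nf at this
      nlinarith
    have hv : (0 : ℝ) ≤ 1 / (2 * ((n : ℝ) - 1) ^ 2) := by positivity
    have ha : (0 : ℝ) ≤ 1 / ((n : ℝ) ^ 3 - n ^ 2 - n) := by positivity
    push_cast
    rw [add_sub_cancel_right, Nat.primesBelow_succ]
    split_ifs with hp
    · rw [Finset.prod_insert (Nat.notMem_primesBelow n)]
      have := mul_le_mul_of_nonneg_left ih (show 0 ≤ 1 + 1 / ((n : ℝ) ^ 3 - n ^ 2 - n) by linarith)
      nlinarith [mul_nonneg ha hv]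
    · linarith

theorem le_prod_primesBelow_one_sub {M : ℕ} (hM : 600 ≤ M) :
    0.88267 * (1 + 1 / (2 * ((M : ℝ) - 2) ^ 2)) ≤
      ∏ p ∈ M.primesBelow.filter (· ≠ 2), (1 - 1 / ((p : ℝ) ^ 3 - 2 * p ^ 2 + 1)) := by
  induction M, hM using Nat.le_induction with
  | base =>
    have hpos : ∀ p ∈ (Nat.primesBelow 600).filter (· ≠ 2),
        (0 : ℝ) < (p : ℝ) ^ 3 - 2 * p ^ 2 + 1 := fun p hp => by
      have : (2 : ℝ) ≤ p := mod_cast Nat.two_le_of_mem_primesBelow (Finset.mem_filter.1 hp).1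
      nlinarith [mul_nonneg (sq_nonneg (p : ℝ)) (sub_nonneg.2 this)]
    have e : ∏ p ∈ (Nat.primesBelow 600).filter (· ≠ 2), (1 - 1 / ((p : ℝ) ^ 3 - 2 * p ^ 2 + 1)) =
        (∏ p ∈ (Nat.primesBelow 600).filter (· ≠ 2), ((p : ℝ) ^ 3 - 2 * p ^ 2)) /
          ∏ p ∈ (Nat.primesBelow 600).filter (· ≠ 2), ((p : ℝ) ^ 3 - 2 * p ^ 2 + 1) := by
      rw [← Finset.prod_div_distrib]
      refine Finset.prod_congr rfl fun p hp => ?_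
      have := (hpos p hp).ne'
      rw [eq_div_iff this, sub_mul, div_mul_cancel₀ _ this]
      ring
    have h : ((_ : ℤ) : ℝ) ≤ ((_ : ℤ) : ℝ) := Int.cast_le.2 le_prod_primesBelow_ne_two_int
    push_cast at h
    rw [e, le_div_iff₀ (Finset.prod_pos hpos)]
    generalize ∏ p ∈ (Nat.primesBelow 600).filter (· ≠ 2), ((p : ℝ) ^ 3 - 2 * p ^ 2 + 1) = x at *
    generalize ∏ p ∈ (Nat.primesBelow 600).filter (· ≠ 2), ((p : ℝ) ^ 3 - 2 * p ^ 2) = y at *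
    norm_num at h ⊢
    linarith
  | succ n hn ih =>
    have hn' : (600 : ℝ) ≤ n := mod_cast hn
    obtain ⟨m, hm⟩ : ∃ m : ℝ, (n : ℝ) = m + 2 := ⟨n - 2, by ring⟩
    have hm' : 598 ≤ m := by linarith
    have hd : (n : ℝ) ^ 3 - 2 * n ^ 2 + 1 = m * (m + 2) ^ 2 + 1 := by rw [hm]; ring
    have e1 : (n : ℝ) - 2 = m := by linarith
    have e2 : ((n + 1 : ℕ) : ℝ) - 2 = m + 1 := by push_cast; linarith
    rw [e1] at ih
    rw [e2, Nat.primesBelow_succ]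
    have key : 1 / (m * (m + 2) ^ 2 + 1) * (1 + 1 / (2 * m ^ 2)) ≤
        1 / (2 * m ^ 2) - 1 / (2 * (m + 1) ^ 2) := by
      rw [← sub_nonneg]
      have : 1 / (2 * m ^ 2) - 1 / (2 * (m + 1) ^ 2) -
          1 / (m * (m + 2) ^ 2 + 1) * (1 + 1 / (2 * m ^ 2)) =
          ((2 * m + 1) * (m * (m + 2) ^ 2 + 1) - (2 * m ^ 2 + 1) * (m + 1) ^ 2) /
            (2 * m ^ 2 * (m + 1) ^ 2 * (m * (m + 2) ^ 2 + 1)) := by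
        field_simp
        ring
      rw [this]
      apply div_nonneg _ (by positivity)
      obtain ⟨k, rfl⟩ : ∃ k, m = k + 1 := ⟨m - 1, by ring⟩
      have : 0 ≤ k := by linarith
      ring_nf
      positivity
    have hv : (0 : ℝ) ≤ 1 / (2 * (m + 1) ^ 2) := by positivity
    have hb : 0 ≤ 1 / (m * (m + 2) ^ 2 + 1) := by positivity
    have hb1 : 1 / (m * (m + 2) ^ 2 + 1) ≤ 1 := by
      rw [div_le_one (by positivity)]
      have : 0 ≤ m * (m + 2) ^ 2 := by positivity
      linarith
    have hbv : 0 ≤ 1 / (m * (m + 2) ^ 2 + 1) * (1 + 1 / (2 * m ^ 2)) := by positivity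
    split_ifs with hp
    · rw [Finset.filter_insert, if_pos (by omega),
        Finset.prod_insert (by simp [Nat.notMem_primesBelow]), hd]
      have := mul_le_mul_of_nonneg_left ih (sub_nonneg.2 hb1)
      nlinarith
    · linarith

theorem prod_primesBelow_le {M : ℕ} (hM : 600 ≤ M) :
    ∏ p ∈ M.primesBelow, (1 + 1 / ((p : ℝ) ^ 2 - p - 1)) ≤ 2.67412 := by
  have e : ∏ p ∈ M.primesBelow, (1 + 1 / ((p : ℝ) ^ 2 - p - 1)) =
      (∏ p ∈ M.primesBelow, (1 + 1 / ((p : ℝ) ^ 3 - p ^ 2 - p))) *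
        ∏ p ∈ M.primesBelow, (1 - 1 / (p : ℝ) ^ 2)⁻¹ := by
    rw [← Finset.prod_mul_distrib]
    refine Finset.prod_congr rfl fun p hp => ?_
    have h2 : (2 : ℝ) ≤ p := mod_cast Nat.two_le_of_mem_primesBelow hp
    have h0 : (p : ℝ) ≠ 0 := by linarith
    have h1 : (p : ℝ) ^ 2 - p - 1 ≠ 0 := by nlinarith
    have h3 : (p : ℝ) ^ 2 - 1 ≠ 0 := by nlinarith
    rw [show (p : ℝ) ^ 3 - p ^ 2 - p = p * (p ^ 2 - p - 1) by ring,
      show 1 - 1 / (p : ℝ) ^ 2 = (p ^ 2 - 1) / p ^ 2 by field_simp]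
    generalize hq : (p : ℝ) ^ 2 - p - 1 = q at *
    field_simp
    rw [← hq]
    ring
  have hz := prod_primesBelow_inv_one_sub_sq_le M
  have hz0 : 0 ≤ ∏ p ∈ M.primesBelow, (1 - 1 / (p : ℝ) ^ 2)⁻¹ :=
    Finset.prod_nonneg fun p hp => by
      have h2 : (2 : ℝ) ≤ p := mod_cast Nat.two_le_of_mem_primesBelow hp
      rw [inv_nonneg, sub_nonneg, div_le_one (by positivity)]
      nlinarith
  have hg : ∏ p ∈ M.primesBelow, (1 + 1 / ((p : ℝ) ^ 3 - p ^ 2 - p)) ≤ 1.625669 := by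
    have := prod_primesBelow_one_add_le hM
    have hv : 0 ≤ 1 / (2 * ((M : ℝ) - 1) ^ 2) := by positivity
    linarith
  rw [e]
  refine (mul_le_mul hg hz hz0 (by norm_num)).trans ?_
  nlinarith [Real.pi_lt_d6, Real.pi_gt_d6]

theorem le_prod_primesBelow_ne_two {M : ℕ} (hM : 600 ≤ M) :
    0.71546 ≤ ∏ p ∈ M.primesBelow.filter (· ≠ 2), (1 - 1 / ((p : ℝ) ^ 2 - p - 1)) := by
  have e : ∏ p ∈ M.primesBelow.filter (· ≠ 2), (1 - 1 / ((p : ℝ) ^ 3 - 2 * p ^ 2 + 1)) =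
      (∏ p ∈ M.primesBelow.filter (· ≠ 2), (1 - 1 / ((p : ℝ) ^ 2 - p - 1))) *
        ∏ p ∈ M.primesBelow.filter (· ≠ 2), (1 - 1 / (p : ℝ) ^ 2)⁻¹ := by
    rw [← Finset.prod_mul_distrib]
    refine Finset.prod_congr rfl fun p hp => ?_
    have h2 : (2 : ℝ) ≤ p := mod_cast Nat.two_le_of_mem_primesBelow (Finset.mem_filter.1 hp).1
    have h0 : (p : ℝ) ≠ 0 := by linarith
    have h1 : (p : ℝ) ^ 2 - p - 1 ≠ 0 := by nlinarith
    have h3 : (p : ℝ) - 1 ≠ 0 := by linarith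
    have h4 : (p : ℝ) + 1 ≠ 0 := by linarith
    rw [show (p : ℝ) ^ 3 - 2 * p ^ 2 + 1 = (p - 1) * (p ^ 2 - p - 1) by ring,
      show 1 - 1 / (p : ℝ) ^ 2 = (p - 1) * (p + 1) / p ^ 2 by field_simp; ring]
    generalize hq : (p : ℝ) ^ 2 - p - 1 = q at *
    field_simp
    rw [← hq]
    ring
  have hz := prod_primesBelow_inv_one_sub_sq_le M
  have h2mem : 2 ∈ M.primesBelow := Nat.mem_primesBelow.2 ⟨by omega, Nat.prime_two⟩
  rw [← Finset.mul_prod_erase _ _ h2mem, ← Finset.filter_ne'] at hz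
  have hg : 0.88267 ≤ ∏ p ∈ M.primesBelow.filter (· ≠ 2),
      (1 - 1 / ((p : ℝ) ^ 3 - 2 * p ^ 2 + 1)) := by
    have := le_prod_primesBelow_one_sub hM
    have hv : 0 ≤ 1 / (2 * ((M : ℝ) - 2) ^ 2) := by positivity
    linarith
  have hA : 0 ≤ ∏ p ∈ M.primesBelow.filter (· ≠ 2), (1 - 1 / ((p : ℝ) ^ 2 - p - 1)) :=
    Finset.prod_nonneg fun p hp => by
      have hp' := Finset.mem_filter.1 hp
      have h3 : 3 ≤ p := by
        have := Nat.two_le_of_mem_primesBelow hp'.1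
        omega
      have h3' : (3 : ℝ) ≤ p := mod_cast h3
      rw [sub_nonneg, div_le_one (by nlinarith)]
      nlinarith
  rw [e] at hg
  norm_num at hz
  have hz' : ∏ p ∈ M.primesBelow.filter (· ≠ 2), (1 - 1 / (p : ℝ) ^ 2)⁻¹ ≤ 1.2337009 := by
    norm_num
    nlinarith [Real.pi_lt_d6, Real.pi_gt_d6]
  have := hg.trans (mul_le_mul_of_nonneg_left hz' hA)
  linarith


theorem stmt_10 :
    Multipliable (fun p : {p : ℕ // p.Prime ∧ p ≠ 2} =>
        (1 - 1 / (((p : ℕ) : ℝ) ^ 2 - ((p : ℕ) : ℝ) - 1))) ∧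
    Multipliable (fun p : {p : ℕ // p.Prime} =>
        (1 + 1 / (((p : ℕ) : ℝ) ^ 2 - ((p : ℕ) : ℝ) - 1))) ∧
    0.71546 ≤ (∏' p : {p : ℕ // p.Prime ∧ p ≠ 2},
        (1 - 1 / (((p : ℕ) : ℝ) ^ 2 - ((p : ℕ) : ℝ) - 1))) ∧
    (∏' p : {p : ℕ // p.Prime}, (1 + 1 / (((p : ℕ) : ℝ) ^ 2 - ((p : ℕ) : ℝ) - 1)))
      ≤ 2.67412 := by
  have hA : Multipliable (fun p : {p : ℕ // p.Prime ∧ p ≠ 2} =>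
      (1 - 1 / (((p : ℕ) : ℝ) ^ 2 - ((p : ℕ) : ℝ) - 1))) := by
    simp_rw [sub_eq_add_neg (1 : ℝ)]
    exact multipliable_one_add_of_summable
      (summable_one_div_sq_sub_sub fun n hn => hn.1).neg.norm
  have hB : Multipliable (fun p : {p : ℕ // p.Prime} =>
      (1 + 1 / (((p : ℕ) : ℝ) ^ 2 - ((p : ℕ) : ℝ) - 1))) :=
    multipliable_one_add_of_summable (summable_one_div_sq_sub_sub fun n hn => hn).norm
  refine ⟨hA, hB, ?_, ?_⟩
  · refine ge_of_tendsto
      (tendsto_prod_range_filter (f := fun n => 1 - 1 / ((n : ℝ) ^ 2 - n - 1)) hA) ?_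
    filter_upwards [Filter.eventually_ge_atTop 600] with M hM
    rw [← Finset.filter_filter]
    exact le_prod_primesBelow_ne_two hM
  · refine le_of_tendsto
      (tendsto_prod_range_filter (f := fun n => 1 + 1 / ((n : ℝ) ^ 2 - n - 1)) hB) ?_
    filter_upwards [Filter.eventually_ge_atTop 600] with M hM
    exact prod_primesBelow_le hM
end

section
/- Let V be a finite-dimensional vector space over ℂ, let n be a natural number, and let W : Fin n → End(V) be a family of pairwise commuting linear maps with W_i ∘ W_i = id for every i. Let T ∈ End(V) commute with every W_i, and let σ : Fin n → ℤ with σ_i ∈ {1, −1} for every i. Let U := {v ∈ V : W_i v = σ_i • v for all i} be the joint eigenspace. Then U is invariant under T, and the trace of the restriction of T to U equals 2^{−n} · Σ_{S ⊆ Fin n} (∏_{i ∈ S} σ_i) · Tr(T ∘ ∏_{i ∈ S} W_i), where the sum is over all subsets S of Fin n and ∏_{i ∈ S} W_i denotes the (well-defined, since the W_i commute) composition of the W_i for i ∈ S. -/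
/-- Multiplying a product of commuting involutions over `S` by the involution of index `i`
toggles the membership of `i` in `S`. -/
theorem mul_noncommProd_of_mul_self_eq_one {ι M : Type*} [DecidableEq ι] [Monoid M] {f : ι → M}
    (hcomm : ∀ i j, Commute (f i) (f j)) {i : ι} (hi : f i * f i = 1) (s : Finset ι) :
    f i * s.noncommProd f (fun a _ b _ _ => hcomm a b) =
      (symmDiff s {i}).noncommProd f (fun a _ b _ _ => hcomm a b) := by
  by_cases h : i ∈ s
  · have hs : symmDiff s {i} = s.erase i := by
      ext j
      simp only [Finset.mem_symmDiff, Finset.mem_singleton, Finset.mem_erase]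
      grind
    rw [← Finset.mul_noncommProd_erase s h f (fun a _ b _ _ => hcomm a b), ← mul_assoc, hi,
      one_mul]
    exact Finset.noncommProd_congr hs.symm (fun _ _ => rfl) _
  · have hs : symmDiff s {i} = insert i s := by
      ext j
      simp only [Finset.mem_symmDiff, Finset.mem_singleton, Finset.mem_insert]
      grind
    rw [← Finset.noncommProd_insert_of_notMem s i f (fun a _ b _ _ => hcomm a b) h]
    exact Finset.noncommProd_congr hs.symm (fun _ _ => rfl) _

/-- A joint eigenvector of commuting endomorphisms is an eigenvector of their products. -/
theorem noncommProd_apply_of_forall_apply_eq_smul {ι R M : Type*} [CommSemiring R]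
    [AddCommMonoid M] [Module R M] {f : ι → Module.End R M}
    {c : ι → R} {v : M} (hv : ∀ i, f i v = c i • v) (s : Finset ι)
    (comm : (s : Set ι).Pairwise (Function.onFun Commute f)) :
    s.noncommProd f comm v = (∏ i ∈ s, c i) • v := by
  classical
  induction s using Finset.induction_on with
  | empty => simp
  | insert a s ha ih =>
    rw [Finset.noncommProd_insert_of_notMem s a f comm ha, Module.End.mul_apply, ih, map_smul, hv,
      smul_smul, Finset.prod_insert ha, mul_comm]

/-- The trace of the restriction to an invariant subspace is the trace of the composition with
any projection onto it. -/
theorem LinearMap.IsProj.trace_restrict {K M : Type*} [Field K] [AddCommGroup M] [Module K M]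
    [FiniteDimensional K M] {p : Submodule K M} {P : Module.End K M} (hP : IsProj p P)
    {T : Module.End K M} (hT : ∀ v ∈ p, T v ∈ p) :
    LinearMap.trace K p (T.restrict hT) = LinearMap.trace K M (T * P) := by
  have h₁ : T * P = (T ∘ₗ p.subtype) ∘ₗ P.codRestrict p hP.map_mem := rfl
  rw [h₁, LinearMap.trace_comp_comm']
  congr 1
  ext v
  exact (hP.map_id _ (hT v v.2)).symm

theorem stmt_11 (V : Type*) [AddCommGroup V] [Module ℂ V] [FiniteDimensional ℂ V]
    (n : ℕ) (W : Fin n → Module.End ℂ V)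
    (hcomm : ∀ i j, Commute (W i) (W j))
    (hinv : ∀ i, W i * W i = 1)
    (T : Module.End ℂ V) (hT : ∀ i, Commute T (W i))
    (σ : Fin n → ℤ) (hσ : ∀ i, σ i = 1 ∨ σ i = -1) :
    ∃ hU : ∀ v ∈ ⨅ i, Module.End.eigenspace (W i) ((σ i : ℂ)),
        T v ∈ ⨅ i, Module.End.eigenspace (W i) ((σ i : ℂ)),
      LinearMap.trace ℂ (⨅ i, Module.End.eigenspace (W i) ((σ i : ℂ)) : Submodule ℂ V)
          (T.restrict hU) =
        (2 : ℂ)⁻¹ ^ n * ∑ S : Finset (Fin n), (∏ i ∈ S, (σ i : ℂ)) *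
          LinearMap.trace ℂ V (T * S.noncommProd W (fun a _ b _ _ => hcomm a b)) := by
  classical
  have hσ' : ∀ i, (σ i : ℂ) * σ i = 1 := fun i => by rcases hσ i with h | h <;> simp [h]
  have hmem : ∀ v : V, v ∈ (⨅ i, Module.End.eigenspace (W i) (σ i : ℂ)) ↔
      ∀ i, W i v = (σ i : ℂ) • v := fun v => by
    simp only [Submodule.mem_iInf, Module.End.mem_eigenspace_iff]
  have hU : ∀ v ∈ ⨅ i, Module.End.eigenspace (W i) (σ i : ℂ),
      T v ∈ ⨅ i, Module.End.eigenspace (W i) (σ i : ℂ) := fun v hv => by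
    rw [hmem] at hv ⊢
    intro i
    rw [← Module.End.mul_apply, ← (hT i).eq, Module.End.mul_apply, hv i, map_smul]
  let P : Module.End ℂ V := (2 : ℂ)⁻¹ ^ n • ∑ S : Finset (Fin n),
    (∏ i ∈ S, (σ i : ℂ)) • S.noncommProd W (fun a _ b _ _ => hcomm a b)
  have hWP : ∀ i, W i * P = (σ i : ℂ) • P := fun i => by
    simp only [P, mul_smul_comm, Finset.mul_sum, Finset.smul_sum]
    refine Fintype.sum_equiv (symmDiff_left_involutive ({i} : Finset (Fin n))).toPerm _ _ ?_
    intro S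
    have hprod := mul_noncommProd_of_mul_self_eq_one
      (fun a b => Commute.all (σ a : ℂ) (σ b : ℂ)) (hσ' i) S
    rw [Finset.noncommProd_eq_prod, Finset.noncommProd_eq_prod] at hprod
    rw [mul_noncommProd_of_mul_self_eq_one hcomm (hinv i),
      Function.Involutive.coe_toPerm, ← hprod, smul_comm (σ i : ℂ), smul_smul (σ i : ℂ),
      ← mul_assoc, hσ', one_mul]
  have hP : LinearMap.IsProj (⨅ i, Module.End.eigenspace (W i) (σ i : ℂ)) P := by
    refine ⟨fun v => (hmem _).2 fun i => ?_, fun v hv => ?_⟩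
    · rw [← Module.End.mul_apply, hWP, LinearMap.smul_apply]
    · have hS : ∀ S : Finset (Fin n), S.noncommProd W (fun a _ b _ _ => hcomm a b) v =
          (∏ i ∈ S, (σ i : ℂ)) • v :=
        fun S => noncommProd_apply_of_forall_apply_eq_smul ((hmem v).1 hv) S _
      simp [P, LinearMap.sum_apply, hS, smul_smul, ← Finset.prod_mul_distrib, hσ',
        ← Nat.cast_smul_eq_nsmul ℂ]
  refine ⟨hU, ?_⟩
  rw [hP.trace_restrict hU]
  simp only [P, mul_smul_comm, Finset.mul_sum, map_smul, map_sum, smul_eq_mul]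
end
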